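/- arXiv:2509.12292 — 3 statements merged into one kernel-verified Lean document; each statement's English description precedes it below -/
import Mathlib

section
/- Let (Ω, 𝓐, μ) be a probability space, M a positive integer, and for each i ∈ {1,…,M} let R_i ⊆ Ω (rejection region of a test φ_i of hypothesis h_i) and S_i ⊆ Ω (rejection region of a test ψ_i of alternative k_i) be measurable sets. Let T ⊆ {1,…,M} and F = {1,…,M} \ T. Define U(ω) = {i : ω ∉ R_i} and L(ω) = {i : ω ∈ S_i}. Assume: (1) the combined procedure controls FWER at level α = 1 − P⋆, i.e. μ((⋃_{i∈T} R_i) ∪ (⋃_{i∈F} S_i)) ≤ α; (2) the compatibility condition R_i ∩ S_i = ∅ holds for every i (no hypothesis and its alternative are rejected simultaneously). Then μ({ω ∈ Ω : L(ω) ⊆ T and T ⊆ U(ω)}) ≥ P⋆, and moreover L(ω) ⊆ U(ω) for every ω ∈ Ω. -/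
open MeasureTheory

/-- Theorem 3.1: if the combined procedure testing all hypotheses (rejection regions
`R i`) and all alternatives (rejection regions `S i`) controls FWER at level
`α = 1 - P⋆`, and no hypothesis and its alternative are rejected simultaneously
(`R i ∩ S i = ∅`), then with probability at least `P⋆` the set of rejected
alternatives `L ω` is contained in `T` and `T` is contained in the set of accepted
hypotheses `U ω`; moreover `L ω ⊆ U ω` always. -/
theorem confidence_set_of_FWER
    {Ω : Type*} [MeasurableSpace Ω] (μ : Measure Ω) [IsProbabilityMeasure μ]
    (M : ℕ) (hM : 0 < M)
    (R S : Fin M → Set Ω) (hR : ∀ i, MeasurableSet (R i)) (hS : ∀ i, MeasurableSet (S i))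
    (T : Set (Fin M)) (P : ENNReal) (hP : P ≤ 1) (α : ENNReal) (hαP : α = 1 - P)
    (hFWER : μ ((⋃ i ∈ T, R i) ∪ ⋃ i ∈ Tᶜ, S i) ≤ α)
    (hcomp : ∀ i, R i ∩ S i = ∅) :
    P ≤ μ {ω : Ω | {i : Fin M | ω ∈ S i} ⊆ T ∧ T ⊆ {i : Fin M | ω ∉ R i}} ∧
      ∀ ω : Ω, {i : Fin M | ω ∈ S i} ⊆ {i : Fin M | ω ∉ R i} := by
  refine ⟨?_, fun ω i hωS hωR => (hcomp i).subset ⟨hωR, hωS⟩⟩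
  have hmeas : MeasurableSet ((⋃ i ∈ T, R i) ∪ ⋃ i ∈ Tᶜ, S i) :=
    (MeasurableSet.biUnion T.to_countable fun i _ => hR i).union
      (MeasurableSet.biUnion Tᶜ.to_countable fun i _ => hS i)
  have hcompl : {ω : Ω | {i : Fin M | ω ∈ S i} ⊆ T ∧ T ⊆ {i : Fin M | ω ∉ R i}} =
      ((⋃ i ∈ T, R i) ∪ ⋃ i ∈ Tᶜ, S i)ᶜ := by
    ext ω
    simp only [Set.mem_ofPred_eq, Set.subset_def, Set.mem_compl_iff, Set.mem_union,
      Set.mem_iUnion]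
    grind
  rw [hcompl, prob_compl_eq_one_sub hmeas]
  calc P = 1 - (1 - P) := (ENNReal.sub_sub_cancel ENNReal.one_ne_top hP).symm
    _ ≤ 1 - μ ((⋃ i ∈ T, R i) ∪ ⋃ i ∈ Tᶜ, S i) := tsub_le_tsub_left (hαP ▸ hFWER) 1
end

section
/- Let (Ω, 𝓐, μ) be a probability space, M a positive integer, α ∈ [0,1], and for each i ∈ {1,…,M} let R_i ⊆ Ω (rejection region of a level-α/M test of hypothesis h_i) and S_i ⊆ Ω (rejection region of a level-α/M test of alternative k_i) be measurable sets with R_i ∩ S_i = ∅ for every i. Let T ⊆ {1,…,M} and F = {1,…,M} \ T, and assume μ(R_i) ≤ α/M for all i ∈ T and μ(S_i) ≤ α/M for all i ∈ F. Define U(ω) = {i : ω ∉ R_i} and L(ω) = {i : ω ∈ S_i}. Then μ({ω ∈ Ω : L(ω) ⊆ T and T ⊆ U(ω)}) ≥ 1 − α. -/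
open MeasureTheory

/-- Section 4.2 (modified Bonferroni procedure `mB(α)`): if each true hypothesis is
falsely rejected with probability at most `α / M`, each true alternative is falsely
rejected with probability at most `α / M`, and no hypothesis and its alternative are
rejected simultaneously, then `L ω ⊆ T ⊆ U ω` with probability at least `1 - α`. -/
theorem modified_bonferroni_coverage
    {Ω : Type*} [MeasurableSpace Ω] (μ : Measure Ω) [IsProbabilityMeasure μ]
    (M : ℕ) (hM : 0 < M) (α : ENNReal) (hα : α ≤ 1)
    (R S : Fin M → Set Ω) (hR : ∀ i, MeasurableSet (R i)) (hS : ∀ i, MeasurableSet (S i))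
    (hcomp : ∀ i, R i ∩ S i = ∅)
    (T : Set (Fin M))
    (hRlevel : ∀ i ∈ T, μ (R i) ≤ α / M)
    (hSlevel : ∀ i ∈ Tᶜ, μ (S i) ≤ α / M) :
    1 - α ≤ μ {ω : Ω | {i : Fin M | ω ∈ S i} ⊆ T ∧ T ⊆ {i : Fin M | ω ∉ R i}} := by
  classical
  set A := {ω : Ω | {i : Fin M | ω ∈ S i} ⊆ T ∧ T ⊆ {i : Fin M | ω ∉ R i}}
  have hsub : Aᶜ ⊆ ⋃ i, if i ∈ T then R i else S i := by
    intro ω hω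
    by_contra hB
    simp only [Set.mem_iUnion, not_exists] at hB
    refine hω ⟨fun i hi => ?_, fun i hi hRi => ?_⟩
    · by_contra hiT
      exact hB i (by simpa [hiT] using hi)
    · exact hB i (by simpa [hi] using hRi)
  have hlevel (i : Fin M) : μ (if i ∈ T then R i else S i) ≤ α / M := by
    split_ifs with hi
    · exact hRlevel i hi
    · exact hSlevel i hi
  have hcompl : μ Aᶜ ≤ α := calc
    μ Aᶜ ≤ ∑ i, μ (if i ∈ T then R i else S i) :=
      (measure_mono hsub).trans (measure_iUnion_fintype_le μ _)
    _ ≤ ∑ _i : Fin M, α / M := Finset.sum_le_sum fun i _ => hlevel i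
    _ = α := by
      rw [Finset.sum_const, Finset.card_univ, Fintype.card_fin, nsmul_eq_mul]
      exact ENNReal.mul_div_cancel (by exact_mod_cast hM.ne') (ENNReal.natCast_ne_top M)
  rw [tsub_le_iff_right]
  calc
    1 = μ (A ∪ Aᶜ) := by rw [Set.union_compl_self, measure_univ]
    _ ≤ μ A + μ Aᶜ := measure_union_le A Aᶜ
    _ ≤ μ A + α := by gcongr
end

section
/- Let M be a positive integer, p, q : {1,…,M} → ℝ, and t : {1,…,M} → ℝ a nonincreasing function (t(L') ≤ t(L) whenever L ≤ L'). Assume that for every index m ∈ {1,…,M} and every L ∈ {1,…,M}, it is not the case that both p(m) < t(L) and q(m) < t(L). Then the following are equivalent: (a) for every pair of disjoint subsets J₁, J₂ ⊆ {1,…,M} with 1 ∈ J₁, one has min( min_{i∈J₁} p(i), min_{j∈J₂} q(j) ) < t(|J₁ ∪ J₂|); (b) p(1) < t(M). -/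
/-- Combinatorial core of Theorem 4.1: with p-values `p i` of the hypotheses,
`q i` of the alternatives, and a nonincreasing threshold function `t` on `{1,…,M}`,
under the compatibility condition that `p m` and `q m` are never simultaneously below
any threshold `t L`, the closed procedure rejects `h 1` (i.e. every union–intersection
test of an intersection hypothesis `H_{J₁,J₂}` with `1 ∈ J₁` rejects) if and only if
the single-step test `p 1 < t M` rejects. -/
theorem closure_single_step
    (M : ℕ) (hM : 0 < M) (p q t : ℕ → ℝ)
    (ht : ∀ L L' : ℕ, 1 ≤ L → L ≤ L' → L' ≤ M → t L' ≤ t L)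
    (hcomp : ∀ m ∈ Finset.Icc 1 M, ∀ L ∈ Finset.Icc 1 M,
      ¬ (p m < t L ∧ q m < t L)) :
    (∀ J₁ J₂ : Finset ℕ, J₁ ⊆ Finset.Icc 1 M → J₂ ⊆ Finset.Icc 1 M →
        Disjoint J₁ J₂ → 1 ∈ J₁ →
        ((∃ i ∈ J₁, p i < t (J₁ ∪ J₂).card) ∨ ∃ j ∈ J₂, q j < t (J₁ ∪ J₂).card))
      ↔ p 1 < t M := by
  classical
  constructor
  · intro h
    let S := fun i : ℕ => i = 1 ∨ ¬ p i < t M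
    have hunion : (Finset.Icc 1 M).filter S ∪ (Finset.Icc 1 M).filter (fun i => ¬ S i)
        = Finset.Icc 1 M := Finset.filter_union_filter_not_eq _ _
    have hrej := h ((Finset.Icc 1 M).filter S) ((Finset.Icc 1 M).filter fun i => ¬ S i)
      (Finset.filter_subset _ _) (Finset.filter_subset _ _)
      (Finset.disjoint_filter_filter_not _ _ _)
      (Finset.mem_filter.2 ⟨Finset.mem_Icc.2 ⟨le_rfl, hM⟩, Or.inl rfl⟩)
    rw [hunion, Nat.card_Icc, Nat.add_sub_cancel] at hrej
    rcases hrej with ⟨i, hi, hpi⟩ | ⟨j, hj, hqj⟩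
    · rcases (Finset.mem_filter.1 hi).2 with rfl | hnot
      · exact hpi
      · exact absurd hpi hnot
    · obtain ⟨hjM, hjS⟩ := Finset.mem_filter.1 hj
      have hpj : p j < t M := not_not.1 (not_or.1 hjS).2
      exact absurd ⟨hpj, hqj⟩ (hcomp j hjM M (Finset.mem_Icc.2 ⟨hM, le_rfl⟩))
  · intro h J₁ J₂ hJ₁ hJ₂ _ h1
    have hpos : 1 ≤ (J₁ ∪ J₂).card := Finset.card_pos.2 ⟨1, Finset.mem_union_left _ h1⟩
    have hle : (J₁ ∪ J₂).card ≤ M := by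
      simpa using Finset.card_le_card (Finset.union_subset hJ₁ hJ₂)
    exact Or.inl ⟨1, h1, h.trans_le (ht _ _ hpos hle le_rfl)⟩
end
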